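/- Let W_enc ∈ ℝ^{d×n}, b_enc ∈ ℝ^d and 1 ≤ K ≤ d. For each K-subset S of {1,…,d} define ν_S := (1/K) Σ_{i∈S} W_encᵀ e_i and β_S := ‖(1/K) Σ_{i∈S} W_encᵀ e_i‖₂² + (1/K) Σ_{i∈S} 2 (b_enc)_i. Then for every K-subset S, Ω_S^TopK = {x ∈ ℝⁿ : ‖x − ν_S‖₂² − β_S < ‖x − ν_T‖₂² − β_T for all K-subsets T ≠ S}; that is, the cells {Ω_S^TopK} form a power diagram with binom(d,K) cells, with centroids ν_S and weights β_S. -/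

import Mathlib

open Finset

/-- The centroid `ν_S := (1/K) Σ_{i∈S} W_encᵀ e_i`. -/
noncomputable def nuS (d n K : ℕ) (Wenc : Matrix (Fin d) (Fin n) ℝ)
    (S : Finset (Fin d)) : Fin n → ℝ :=
  fun j => (K : ℝ)⁻¹ * ∑ i ∈ S, Wenc i j

/-- The weight `β_S := ‖ν_S‖² + (1/K) Σ_{i∈S} 2 (b_enc)_i`. -/
noncomputable def betaS (d n K : ℕ) (Wenc : Matrix (Fin d) (Fin n) ℝ)
    (benc : Fin d → ℝ) (S : Finset (Fin d)) : ℝ :=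
  (∑ j, (nuS d n K Wenc S j) ^ 2) + (K : ℝ)⁻¹ * ∑ i ∈ S, 2 * benc i

/-- The power distance is, up to a term independent of `S`, minus twice the average over `S` of
the pre-activations. -/
lemma sum_sub_nuS_sq_sub_betaS (d n K : ℕ) (Wenc : Matrix (Fin d) (Fin n) ℝ)
    (benc : Fin d → ℝ) (S : Finset (Fin d)) (x : Fin n → ℝ) :
    (∑ j, (x j - nuS d n K Wenc S j) ^ 2) - betaS d n K Wenc benc S
      = (∑ j, x j ^ 2) - 2 * (K : ℝ)⁻¹ * ∑ i ∈ S, (Wenc.mulVec x + benc) i := by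
  have hcross : ∑ j, x j * nuS d n K Wenc S j = (K : ℝ)⁻¹ * ∑ i ∈ S, Wenc.mulVec x i := by
    simp only [nuS, Matrix.mulVec, dotProduct, Finset.mul_sum]
    rw [Finset.sum_comm]
    exact Finset.sum_congr rfl fun i _ => Finset.sum_congr rfl fun j _ => by ring
  have hexpand : ∑ j, (x j - nuS d n K Wenc S j) ^ 2
      = ∑ j, x j ^ 2 - 2 * ∑ j, x j * nuS d n K Wenc S j + ∑ j, nuS d n K Wenc S j ^ 2 := by
    rw [Finset.mul_sum, ← Finset.sum_sub_distrib, ← Finset.sum_add_distrib]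
    exact Finset.sum_congr rfl fun j _ => by ring
  rw [hexpand, hcross, betaS, ← Finset.mul_sum]
  simp only [Pi.add_apply, Finset.sum_add_distrib]
  ring

/-- A finite set strictly dominates its complement pointwise if and only if it is the unique
maximizer of the sum among the sets of its cardinality. -/
lemma forall_lt_iff_forall_sum_lt {ι : Type*} [DecidableEq ι] (z : ι → ℝ) (S : Finset ι) :
    (∀ i ∈ S, ∀ j ∉ S, z j < z i) ↔
      ∀ T : Finset ι, T.card = S.card → T ≠ S → ∑ i ∈ T, z i < ∑ i ∈ S, z i := by
  constructor
  · intro h T hcard hne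
    have hcard' : (T \ S).card = (S \ T).card := Finset.card_sdiff_comm hcard
    have hTS : (T \ S).Nonempty := Finset.sdiff_nonempty.2 fun hsub =>
      hne (Finset.eq_of_subset_of_card_le hsub hcard.ge)
    have hST : (S \ T).Nonempty := Finset.card_pos.1 (hcard' ▸ hTS.card_pos)
    obtain ⟨m, hm, hmax⟩ := Finset.exists_max_image (T \ S) z hTS
    have hlt : ∑ i ∈ T \ S, z i < ∑ i ∈ S \ T, z i := calc
      ∑ i ∈ T \ S, z i ≤ (T \ S).card • z m := Finset.sum_le_card_nsmul _ _ _ hmax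
      _ = ∑ _i ∈ S \ T, z m := by rw [hcard', Finset.sum_const]
      _ < ∑ i ∈ S \ T, z i := Finset.sum_lt_sum_of_nonempty hST fun i hi =>
        h i (Finset.mem_sdiff.1 hi).1 m (Finset.mem_sdiff.1 hm).2
    have hT := Finset.sum_inter_add_sum_sdiff T S z
    have hS := Finset.sum_inter_add_sum_sdiff S T z
    rw [Finset.inter_comm] at hS
    linarith
  · intro h i hi j hj
    have hj' : j ∉ S.erase i := fun hmem => hj (Finset.mem_of_mem_erase hmem)
    have hlt := h (insert j (S.erase i))
      (by rw [Finset.card_insert_of_notMem hj', Finset.card_erase_add_one hi])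
      (fun heq => hj (heq ▸ Finset.mem_insert_self _ _))
    rw [Finset.sum_insert hj', ← Finset.add_sum_erase S z hi] at hlt
    linarith

/-- The cells `{Ω_S^TopK}` form a power diagram with `binom(d,K)` cells, with
centroids `ν_S` and weights `β_S`. -/
theorem topK_cells_form_power_diagram
    (d n K : ℕ) (hK1 : 1 ≤ K) (hKd : K ≤ d)
    (Wenc : Matrix (Fin d) (Fin n) ℝ) (benc : Fin d → ℝ) :
    ∀ S : Finset (Fin d), S.card = K →
      {x : Fin n → ℝ | ∀ i ∈ S, ∀ j ∉ S,
          (Wenc.mulVec x + benc) j < (Wenc.mulVec x + benc) i}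
        = {x : Fin n → ℝ | ∀ T : Finset (Fin d), T.card = K → T ≠ S →
          (∑ j, (x j - nuS d n K Wenc S j) ^ 2) - betaS d n K Wenc benc S
            < (∑ j, (x j - nuS d n K Wenc T j) ^ 2) - betaS d n K Wenc benc T} := by
  rintro S rfl
  have hK : (0 : ℝ) < 2 * (S.card : ℝ)⁻¹ := by
    have : (0 : ℝ) < S.card := by exact_mod_cast hK1
    positivity
  ext x
  simp only [Set.mem_ofPred_eq, sum_sub_nuS_sq_sub_betaS, sub_lt_sub_iff_left,
    mul_lt_mul_iff_right₀ hK]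
  exact forall_lt_iff_forall_sum_lt _ S
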